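/- Let R be a noetherian integrally closed integral domain with field of fractions F, let A be a central simple F-algebra, and let Δ be an R-order in A. Then for every a ∈ Δ, the reduced characteristic polynomial of a has coefficients in R; in particular the reduced norm of a lies in R. -/

import Mathlib

open scoped TensorProduct

open Polynomial in
theorem Matrix.charpoly_dvd_map_pow {R E m : Type*} [CommRing R] [CommRing E] [Algebra R E]
    [Fintype m] [DecidableEq m] (M : Matrix m m E) (f : R[X]) (hf : aeval M f = 0) :
    M.charpoly ∣ f.map (algebraMap R E) ^ Fintype.card m := by
  set g : E[X] := f.map (algebraMap R E) with hg
  have hgM : aeval M g = 0 := by rw [hg, aeval_map_algebraMap, hf]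
  have key : M.charmatrix ∣ Matrix.scalar m g := by
    have h1 := sub_dvd_eval_sub (C X) X ((g.map (C : E →+* E[X])).map (C : E[X] →+* E[X][X]))
    have h2 := map_dvd (aeval (R := E[X]) ((C : E →+* E[X]).mapMatrix M)) h1
    convert! h2 using 1
    · simp [charmatrix, Matrix.algebraMap_eq_diagonal]
    · have e1 : eval (C X) ((g.map (C : E →+* E[X])).map (C : E[X] →+* E[X][X])) = C g := by
        rw [eval_map, eval₂_hom, eval_map, ← Polynomial.eval₂_C_X (p := g)]
        simp
      have e2 : eval X ((g.map (C : E →+* E[X])).map (C : E[X] →+* E[X][X]))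
          = g.map (C : E →+* E[X]) := by
        rw [eval_map, eval₂_C_X]
      have e3 : aeval ((C : E →+* E[X]).mapMatrix M) (g.map (C : E →+* E[X])) =
          (C : E →+* E[X]).mapMatrix (aeval M g) := by
        rw [aeval_def, eval₂_map, aeval_def, hom_eval₂]
        congr 1
        ext x i j : 3
        simp [Matrix.algebraMap_matrix_apply, apply_ite]
      rw [e1, e2, map_sub, e3, hgM, aeval_C, map_zero, sub_zero]
      rfl
  obtain ⟨N, hN⟩ := key
  refine ⟨N.det, ?_⟩
  rw [Matrix.charpoly, ← Matrix.det_mul, ← hN]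
  simp

/-- The matrix with columns `v, Mv, M²v, …`. -/
def Matrix.krylov {R : Type*} [CommRing R] {n : ℕ} (M : Matrix (Fin n) (Fin n) R)
    (v : Fin n → R) : Matrix (Fin n) (Fin n) R :=
  Matrix.of fun i j => (M ^ (j : ℕ)).mulVec v i

open Polynomial in
theorem Matrix.eq_zero_of_aeval_eq_zero_of_det_krylov_ne_zero {E : Type*} [Field E] {n : ℕ}
    {M : Matrix (Fin n) (Fin n) E} {v : Fin n → E} (hv : (M.krylov v).det ≠ 0)
    {q : E[X]} (hq : q.degree < n) (hqM : aeval M q = 0) : q = 0 := by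
  by_cases h : q = 0
  · exact h
  have h0 : (M.krylov v).mulVec (fun j => q.coeff j) = 0 := by
    have h1 : (aeval M q).mulVec v = 0 := by rw [hqM, Matrix.zero_mulVec]
    rw [← h1, aeval_def, eval₂_eq_sum, sum_over_range' _ (by simp) n
      ((natDegree_lt_iff_degree_lt h).2 hq), ← Fin.sum_univ_eq_sum_range
        (fun i => algebraMap E (Matrix (Fin n) (Fin n) E) (q.coeff i) * M ^ i),
      Matrix.sum_mulVec]
    ext i
    simp only [← Algebra.smul_def, Matrix.smul_mulVec, Finset.sum_apply, Pi.smul_apply,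
      smul_eq_mul, Matrix.mulVec, dotProduct, krylov, Matrix.of_apply]
    exact Finset.sum_congr rfl fun j _ => mul_comm _ _
  have h2 := Matrix.eq_zero_of_mulVec_eq_zero hv h0
  ext j
  by_cases hj : j < n
  · exact congrFun h2 ⟨j, hj⟩
  · exact coeff_eq_zero_of_degree_lt (hq.trans_le (by exact_mod_cast not_lt.1 hj))

theorem exists_linear_retraction (F E : Type*) [Field F] [Field E] [Algebra F E] :
    ∃ π : E →ₗ[F] F, ∀ t : F, π (algebraMap F E t) = t := by
  obtain ⟨π, hπ⟩ := (Algebra.linearMap F E).exists_leftInverse_of_injective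
    (LinearMap.ker_eq_bot.2 (algebraMap F E).injective)
  exact ⟨π, fun t => LinearMap.congr_fun hπ t⟩

theorem MvPolynomial.eval_mem_range_of_eval_ne_zero {F E σ : Type*} [Field F] [Field E]
    [Algebra F E] [Infinite F] {p g : MvPolynomial σ E} (hg : g ≠ 0)
    (h : ∀ x : σ → F, eval (algebraMap F E ∘ x) g ≠ 0 →
      eval (algebraMap F E ∘ x) p ∈ (algebraMap F E).range) (x : σ → F) :
    eval (algebraMap F E ∘ x) p ∈ (algebraMap F E).range := by
  obtain ⟨π, hπ⟩ := exists_linear_retraction F E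
  let p' : MvPolynomial σ E := ∑ m ∈ p.support, monomial m (algebraMap F E (π (p.coeff m)))
  have hp' (y : σ → F) : eval (algebraMap F E ∘ y) p' =
      algebraMap F E (π (eval (algebraMap F E ∘ y) p)) := by
    rw [eval_eq (algebraMap F E ∘ y) p]
    simp only [p', map_sum, eval_monomial, Function.comp_apply, Finsupp.prod, ← map_pow,
      ← map_prod]
    refine Finset.sum_congr rfl fun m _ => ?_
    rw [mul_comm (p.coeff m), ← Algebra.smul_def _ (p.coeff m), map_smul, smul_eq_mul, map_mul,
      mul_comm]
  have hpp : (p - p') * g = 0 := by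
    refine funext_set (fun _ => Set.range (algebraMap F E))
      (fun _ => Set.infinite_range_of_injective (algebraMap F E).injective) fun y hy => ?_
    choose z hz using fun i => hy i trivial
    obtain rfl : algebraMap F E ∘ z = y := _root_.funext hz
    by_cases h0 : eval (algebraMap F E ∘ z) g = 0
    · simp [h0]
    · obtain ⟨t, ht⟩ := h z h0
      simp [hp', ← ht, hπ]
  have : p = p' := sub_eq_zero.1 ((mul_eq_zero.1 hpp).resolve_right hg)
  rw [this, hp']
  exact ⟨_, rfl⟩

section Splitting

variable {F E A : Type*} [Field F] [Field E] [Algebra F E] [Ring A] [Algebra F A] {n : ℕ}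
  (φ : (E ⊗[F] A) ≃ₐ[E] Matrix (Fin n) (Fin n) E)

open Polynomial in
theorem aeval_splitting (a : A) (p : F[X]) :
    aeval (φ (1 ⊗ₜ[F] a)) (p.map (algebraMap F E)) = φ (1 ⊗ₜ[F] aeval a p) := by
  have := (aeval_algHom_apply ((φ.toAlgHom.restrictScalars F).comp
    (Algebra.TensorProduct.includeRight : A →ₐ[F] E ⊗[F] A)) a p)
  rw [aeval_map_algebraMap]
  exact this

open Polynomial in
theorem charpoly_splitting_coeff_mem_range_of_krylov (a : A) (v : Fin n → E)
    (hv : ((φ (1 ⊗ₜ[F] a)).krylov v).det ≠ 0) (i : ℕ) :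
    (φ (1 ⊗ₜ[F] a)).charpoly.coeff i ∈ (algebraMap F E).range := by
  obtain ⟨π, hπ⟩ := exists_linear_retraction F E
  set M := φ (1 ⊗ₜ[F] a) with hM
  set P := M.charpoly with hP
  have hPdeg : P.natDegree = n := by simp [hP]
  have hPmon : P.Monic := M.charpoly_monic
  let p : F[X] := ∑ j ∈ Finset.range (n + 1), C (π (P.coeff j)) * X ^ j
  have hcoeff (j : ℕ) : p.coeff j = π (P.coeff j) := by
    simp only [p, finsetSum_coeff, coeff_C_mul_X_pow, Finset.sum_ite_eq, Finset.mem_range]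
    split_ifs with h
    · rfl
    · rw [coeff_eq_zero_of_natDegree_lt (by omega), map_zero]
  have hpa : aeval a p = 0 := by
    have h1 : ∑ j ∈ Finset.range (n + 1), P.coeff j ⊗ₜ[F] (a ^ j) = 0 := by
      apply φ.injective
      rw [map_zero, ← M.aeval_self_charpoly, ← hP, aeval_eq_sum_range, hPdeg, map_sum]
      refine Finset.sum_congr rfl fun j _ => ?_
      rw [hM, ← map_pow, ← map_smul, Algebra.TensorProduct.tmul_pow, one_pow,
        TensorProduct.smul_tmul', smul_eq_mul, mul_one]
    have h2 := congrArg ((TensorProduct.lid F A).toLinearMap ∘ₗ π.rTensor A) h1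
    simpa [p, Algebra.smul_def] using h2
  have hq : P - p.map (algebraMap F E) = 0 := by
    refine Matrix.eq_zero_of_aeval_eq_zero_of_det_krylov_ne_zero hv ?_ ?_
    · rw [degree_lt_iff_coeff_zero]
      intro m hm
      rw [coeff_sub, coeff_map, hcoeff]
      rcases hm.eq_or_lt with rfl | hm
      · have : P.coeff n = algebraMap F E 1 := by
          rw [map_one, ← hPmon.coeff_natDegree, hPdeg]
        rw [this, hπ, sub_self]
      · rw [coeff_eq_zero_of_natDegree_lt (by omega), map_zero, map_zero, sub_zero]
    · rw [map_sub, hP, M.aeval_self_charpoly, aeval_splitting, hpa]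
      simp
  rw [sub_eq_zero.1 hq, coeff_map]
  exact ⟨_, rfl⟩

theorem charpoly_splitting_coeff_mem_range_of_infinite [Infinite F] [FiniteDimensional F A]
    (a : A) (i : ℕ) : (φ (1 ⊗ₜ[F] a)).charpoly.coeff i ∈ (algebraMap F E).range := by
  have : Infinite E := Infinite.of_injective _ (algebraMap F E).injective
  let b := Module.finBasis F A
  let σ := Fin (Module.finrank F A)
  let G : Matrix (Fin n) (Fin n) (MvPolynomial σ E) :=
    ∑ k, (MvPolynomial.X k : MvPolynomial σ E) • (φ (1 ⊗ₜ[F] b k)).map MvPolynomial.C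
  have hG (x : σ → E) : (MvPolynomial.eval x).mapMatrix G = φ (∑ k, x k ⊗ₜ[F] b k) := by
    simp only [G, map_sum]
    refine Finset.sum_congr rfl fun k _ => ?_
    have h : x k ⊗ₜ[F] b k = x k • ((1 : E) ⊗ₜ[F] b k) := by simp [TensorProduct.smul_tmul']
    rw [h, map_smul φ]
    ext
    simp only [RingHom.mapMatrix_apply, Matrix.map_apply, Matrix.smul_apply, smul_eq_mul,
      map_mul, MvPolynomial.eval_X, MvPolynomial.eval_C]
  let g : MvPolynomial σ E := (G.krylov 1).det
  have hgx (x : σ → E) : MvPolynomial.eval x g =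
      ((φ (∑ k, x k ⊗ₜ[F] b k)).krylov 1).det := by
    rw [← hG, RingHom.map_det]
    congr 1
    ext r s
    simp only [Matrix.krylov, RingHom.mapMatrix_apply, Matrix.map_apply, Matrix.of_apply]
    rw [RingHom.map_mulVec, Matrix.map_pow]
    congr 2
    ext
    simp
  have hpx (x : σ → E) : MvPolynomial.eval x (G.charpoly.coeff i) =
      (φ (∑ k, x k ⊗ₜ[F] b k)).charpoly.coeff i := by
    rw [← hG, RingHom.mapMatrix_apply, Matrix.charpoly_map, Polynomial.coeff_map]
  have hsum (x : σ → F) : ∑ k, (algebraMap F E ∘ x) k ⊗ₜ[F] b k = 1 ⊗ₜ[F] ∑ k, x k • b k := by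
    rw [TensorProduct.tmul_sum]
    refine Finset.sum_congr rfl fun k _ => ?_
    rw [Function.comp_apply, Algebra.algebraMap_eq_smul_one, TensorProduct.smul_tmul]
  have hg : g ≠ 0 := by
    let d : Fin n → E := fun k => Infinite.natEmbedding E k
    have hd : Function.Injective d :=
      (Infinite.natEmbedding E).injective.comp Fin.val_injective
    let B := Algebra.TensorProduct.basis E b
    intro h0
    have h1 := hgx (B.repr (φ.symm (Matrix.diagonal d)))
    have h2 : ∑ k, B.repr (φ.symm (Matrix.diagonal d)) k ⊗ₜ[F] b k =
        φ.symm (Matrix.diagonal d) := by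
      conv_rhs => rw [← B.sum_repr (φ.symm (Matrix.diagonal d))]
      refine Finset.sum_congr rfl fun k _ => ?_
      rw [Algebra.TensorProduct.basis_repr_symm_apply']
    rw [h0, map_zero, h2, AlgEquiv.apply_symm_apply] at h1
    refine Matrix.det_vandermonde_ne_zero_iff.2 hd (Eq.trans ?_ h1.symm)
    congr 1
    ext r s
    simp [Matrix.krylov, Matrix.diagonal_pow, Matrix.mulVec_diagonal, Matrix.vandermonde]
  have key := MvPolynomial.eval_mem_range_of_eval_ne_zero (F := F) (p := G.charpoly.coeff i) hg
    (fun x hx => by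
      rw [hgx, hsum] at hx
      rw [hpx, hsum]
      exact charpoly_splitting_coeff_mem_range_of_krylov φ _ _ hx i) (b.repr a)
  rwa [hpx, hsum, b.sum_repr] at key

open Polynomial in
theorem Matrix.charpoly_lmul {R : Type*} [CommRing R] [Nontrivial R]
    (M : Matrix (Fin n) (Fin n) R) :
    (Algebra.lmul R (Matrix (Fin n) (Fin n) R) M).charpoly = M.charpoly ^ n := by
  have h : LinearMap.toMatrix (Matrix.stdBasis R (Fin n) (Fin n))
      (Matrix.stdBasis R (Fin n) (Fin n)) (Algebra.lmul R (Matrix (Fin n) (Fin n) R) M) =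
      Matrix.blockDiagonal fun _ : Fin n => M := by
    ext ⟨i, k⟩ ⟨j, l⟩
    rw [LinearMap.toMatrix_apply, Matrix.stdBasis_eq_single, Matrix.blockDiagonal_apply]
    simp [Matrix.stdBasis, Matrix.mul_apply, Matrix.single_apply, ite_and, eq_comm]
  have h' : (Matrix.blockDiagonal fun _ : Fin n => M).charmatrix =
      Matrix.blockDiagonal fun _ : Fin n => M.charmatrix := by
    ext ⟨i, k⟩ ⟨j, l⟩ : 2
    simp only [Matrix.charmatrix_apply, Matrix.blockDiagonal_apply, Matrix.diagonal_apply,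
      Prod.mk.injEq]
    split_ifs <;> simp_all
  rw [← LinearMap.charpoly_toMatrix _ (Matrix.stdBasis R (Fin n) (Fin n)), h, Matrix.charpoly, h',
    Matrix.det_blockDiagonal]
  simp [Matrix.charpoly]

theorem charpoly_splitting_pow [FiniteDimensional F A] (a : A) :
    (φ (1 ⊗ₜ[F] a)).charpoly ^ n =
      (Algebra.lmul F A a).charpoly.map (algebraMap F E) := by
  rw [← Matrix.charpoly_lmul, ← LinearMap.charpoly_baseChange, Algebra.baseChange_lmul,
    ← LinearEquiv.charpoly_conj φ.toLinearEquiv]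
  congr 1
  ext1 x
  simp [LinearEquiv.conj_apply]

open Polynomial in
theorem mem_range_algebraMap_of_pow_card_eq {F E : Type*} [Field F] [Fintype F] [Field E]
    [Algebra F E] {c : E} (hc : c ^ Fintype.card F = c) : c ∈ (algebraMap F E).range := by
  have hroots := FiniteField.roots_X_pow_card_sub_X F
  have hcard := Fintype.one_lt_card (α := F)
  have hsplit : (X ^ Fintype.card F - X : F[X]).Splits := by
    rw [splits_iff_card_roots, hroots, FiniteField.X_pow_card_sub_X_natDegree_eq F hcard]
    rfl
  have hmem : c ∈ ((X ^ Fintype.card F - X : F[X]).map (algebraMap F E)).roots := by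
    rw [mem_roots (map_ne_zero (FiniteField.X_pow_card_sub_X_ne_zero F hcard))]
    simp [hc]
  rw [hsplit.roots_map, Multiset.mem_map] at hmem
  obtain ⟨t, -, ht⟩ := hmem
  exact ⟨t, ht⟩

open Polynomial in
theorem charpoly_splitting_coeff_mem_range_of_finite [Finite F] [FiniteDimensional F A]
    (hn : n ≠ 0) (a : A) (i : ℕ) :
    (φ (1 ⊗ₜ[F] a)).charpoly.coeff i ∈ (algebraMap F E).range := by
  have := Fintype.ofFinite F
  set P := (φ (1 ⊗ₜ[F] a)).charpoly with hP
  let s : E →ₐ[F] E := FiniteField.frobeniusAlgHom F E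
  have h1 : (P.map (s : E →+* E)) ^ n = P ^ n := by
    rw [← Polynomial.map_pow, charpoly_splitting_pow, Polynomial.map_map]
    congr 1
    exact s.comp_algebraMap
  have hmon : P.Monic := Matrix.charpoly_monic _
  have h2 : P.map (s : E →+* E) = P :=
    eq_of_monic_of_associated (hmon.map _) hmon (associated_of_dvd_dvd
      ((UniqueFactorizationMonoid.pow_dvd_pow_iff_dvd hn).1 h1.dvd)
      ((UniqueFactorizationMonoid.pow_dvd_pow_iff_dvd hn).1 h1.symm.dvd))
  apply mem_range_algebraMap_of_pow_card_eq
  conv_rhs => rw [← h2, coeff_map]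
  rfl

theorem charpoly_splitting_coeff_mem_range [Nontrivial A] [FiniteDimensional F A] (a : A) (i : ℕ) :
    (φ (1 ⊗ₜ[F] a)).charpoly.coeff i ∈ (algebraMap F E).range := by
  rcases finite_or_infinite F with hF | hF
  · refine charpoly_splitting_coeff_mem_range_of_finite φ ?_ a i
    rintro rfl
    exact not_subsingleton (E ⊗[F] A) φ.injective.subsingleton
  · exact charpoly_splitting_coeff_mem_range_of_infinite φ a i

end Splitting

/-- Let `R` be a noetherian integrally closed integral domain with
field of fractions `F`, `A` a central simple `F`-algebra (of degree `n`, split by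
`E` via `φ`), and `Δ` an `R`-order in `A` (a subring, finitely generated as
`R`-module, spanning `A` over `F`).  Then for every `a ∈ Δ` the reduced
characteristic polynomial of `a` (the characteristic polynomial of `φ(1 ⊗ a)`)
has all coefficients in (the image of) `R`; in particular the reduced norm
`(−1)ⁿ·rcp(a)(0)` of `a` lies in `R`. -/
theorem reduced_charpoly_integral
    (R : Type) [CommRing R] [IsDomain R] [IsNoetherianRing R] [IsIntegrallyClosed R]
    (F : Type) [Field F] [Algebra R F] [IsFractionRing R F]
    (A : Type) [Ring A] [Algebra F A] [Algebra R A] [IsScalarTower R F A]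
    [FiniteDimensional F A]
    (hcentral : Subalgebra.center F A = ⊥) (hsimple : IsSimpleRing A)
    (n : ℕ) (hdim : Module.finrank F A = n ^ 2)
    (E : Type) [Field E] [Algebra F E] [Algebra R E] [IsScalarTower R F E]
    (φ : (E ⊗[F] A) ≃ₐ[E] Matrix (Fin n) (Fin n) E)
    (Δ : Subalgebra R A) (hfin : Module.Finite R Δ)
    (hspan : ∀ a : A, ∃ d : R, d ≠ 0 ∧ d • a ∈ Δ) :
    ∀ a ∈ Δ,
      (∀ i : ℕ, (Matrix.charpoly (φ (1 ⊗ₜ[F] a))).coeff i ∈ (algebraMap R E).range) ∧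
      (-1 : E) ^ n * Polynomial.eval 0 (Matrix.charpoly (φ (1 ⊗ₜ[F] a))) ∈
        (algebraMap R E).range := by
  intro a ha
  have hcoeff (i : ℕ) :
      (Matrix.charpoly (φ (1 ⊗ₜ[F] a))).coeff i ∈ (algebraMap R E).range := by
    obtain ⟨c, hc⟩ := charpoly_splitting_coeff_mem_range φ a i
    have hint : IsIntegral R a :=
      (Algebra.IsIntegral.isIntegral (R := R) (⟨a, ha⟩ : Δ)).map Δ.val
    obtain ⟨f, hfmon, hfa⟩ := hint
    have hfM : Polynomial.aeval (φ (1 ⊗ₜ[F] a)) f = 0 := by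
      have h := aeval_splitting φ a (f.map (algebraMap R F))
      rw [Polynomial.aeval_map_algebraMap, Polynomial.aeval_map_algebraMap,
        Polynomial.aeval_map_algebraMap] at h
      rw [h, Polynomial.aeval_def, hfa, TensorProduct.tmul_zero, map_zero]
    have hE : IsIntegral R (algebraMap F E c) := by
      rw [hc]
      refine Polynomial.isIntegral_coeff_of_dvd (f ^ n) _ (hfmon.pow n)
        (Matrix.charpoly_monic _) ?_ i
      simpa using Matrix.charpoly_dvd_map_pow (φ (1 ⊗ₜ[F] a)) f hfM
    obtain ⟨r, rfl⟩ := IsIntegrallyClosed.isIntegral_iff.1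
      ((isIntegral_algebraMap_iff (algebraMap F E).injective).1 hE)
    exact ⟨r, by rw [← hc, ← IsScalarTower.algebraMap_apply]⟩
  refine ⟨hcoeff, ?_⟩
  rw [← Polynomial.coeff_zero_eq_eval_zero]
  exact mul_mem (pow_mem (neg_mem (one_mem _)) n) (hcoeff 0)
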